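/- arXiv:2104.10341 — 5 statements merged into one kernel-verified Lean document; each statement's English description precedes it below -/
import Mathlib

section
/- (Pontryagin's Criterion) A countable torsion-free abelian group G is free (as a ℤ-module) if and only if every subgroup of G of finite torsion-free rank is free. -/
open Module Cardinal nonZeroDivisors

namespace Submodule

variable {R M : Type*} [CommRing R] [IsDomain R] [AddCommGroup M] [Module R M]

/-- The elements having a nonzero multiple in `N`. -/
def torsionClosure (N : Submodule R M) : Submodule R M :=
  (torsion R (M ⧸ N)).comap N.mkQ

lemma mem_torsionClosure {N : Submodule R M} {x : M} :
    x ∈ N.torsionClosure ↔ ∃ a : R, a ≠ 0 ∧ a • x ∈ N := by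
  rw [torsionClosure, mem_comap, mem_torsion_iff]
  constructor
  · rintro ⟨a, ha⟩
    refine ⟨a, nonZeroDivisors.coe_ne_zero a, ?_⟩
    rw [← Quotient.mk_eq_zero, Quotient.mk_smul]
    exact ha
  · rintro ⟨a, ha, hx⟩
    refine ⟨⟨a, mem_nonZeroDivisors_of_ne_zero ha⟩, ?_⟩
    rw [← Quotient.mk_eq_zero, Quotient.mk_smul] at hx
    exact hx

lemma le_torsionClosure (N : Submodule R M) : N ≤ N.torsionClosure := fun x hx ↦
  mem_torsionClosure.2 ⟨1, one_ne_zero, by simpa using hx⟩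

lemma torsionClosure_mono : Monotone (torsionClosure : Submodule R M → Submodule R M) := by
  intro N P h x hx
  obtain ⟨a, ha, hx⟩ := mem_torsionClosure.1 hx
  exact mem_torsionClosure.2 ⟨a, ha, h hx⟩

lemma torsionClosure_bot [IsTorsionFree R M] : (⊥ : Submodule R M).torsionClosure = ⊥ := by
  refine eq_bot_iff.2 fun x hx ↦ ?_
  obtain ⟨a, ha, hx⟩ := mem_torsionClosure.1 hx
  simpa [ha] using hx

instance isTorsionFree_quotient_torsionClosure (N : Submodule R M) :
    IsTorsionFree R (M ⧸ N.torsionClosure) := by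
  refine .of_smul_eq_zero fun r m ↦ ?_
  induction m using Submodule.Quotient.induction_on with
  | H x =>
    intro h
    rw [← Quotient.mk_smul, Quotient.mk_eq_zero] at h
    obtain ⟨a, ha, hx⟩ := mem_torsionClosure.1 h
    refine or_iff_not_imp_left.2 fun hr ↦ (Quotient.mk_eq_zero _).2 ?_
    exact mem_torsionClosure.2 ⟨a * r, mul_ne_zero ha hr, by rwa [mul_smul]⟩

lemma rank_torsionClosure (N : Submodule R M) :
    Module.rank R N.torsionClosure = Module.rank R N := by
  rw [← rank_quotient_add_rank (N.submoduleOf N.torsionClosure),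
    (submoduleOfEquivOfLe N.le_torsionClosure).rank_eq, rank_eq_zero_iff.2, zero_add]
  intro m
  induction m using Submodule.Quotient.induction_on with
  | H x =>
    obtain ⟨a, ha, hx⟩ := mem_torsionClosure.1 x.2
    exact ⟨a, ha, by rw [← Quotient.mk_smul, Quotient.mk_eq_zero]; exact hx⟩

lemma exists_finite_torsionClosure_span_eq_top (h : Module.rank R M < ℵ₀) :
    ∃ s : Set M, s.Finite ∧ (span R s).torsionClosure = ⊤ := by
  obtain ⟨s, hs, hli⟩ := exists_set_linearIndependent R M
  have hfin : #s < ℵ₀ := hs ▸ h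
  refine ⟨s, lt_aleph0_iff_set_finite.1 hfin, eq_top_iff.2 fun x _ ↦ ?_⟩
  have hq := rank_quotient_add_rank (span R s)
  rw [rank_span_set (linearIndependent_subtype_iff.1 hli), ← hs] at hq
  have h0 : Module.rank R (M ⧸ span R s) = 0 :=
    (Cardinal.add_right_inj_of_lt_aleph0 hfin).1 (by rw [hq, zero_add])
  obtain ⟨a, ha, hx⟩ := rank_eq_zero_iff.1 h0 (Quotient.mk x)
  rw [← Quotient.mk_smul, Quotient.mk_eq_zero] at hx
  exact mem_torsionClosure.2 ⟨a, ha, hx⟩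

/-- A submodule of finite rank of a free module over a Noetherian domain is finitely generated. -/
lemma finite_of_rank_lt_aleph0 [IsNoetherianRing R] [Free R M] (N : Submodule R M)
    (h : Module.rank R N < ℵ₀) : Module.Finite R N := by
  obtain ⟨s, hs, htop⟩ := exists_finite_torsionClosure_span_eq_top h
  let b := Free.chooseBasis R M
  let T := ⋃ x ∈ s, ((b.repr (x : M)).support : Set (Free.ChooseBasisIndex R M))
  have hT : T.Finite := hs.biUnion fun x _ ↦ Finset.finite_toSet _
  have hsT : (span R s).map N.subtype ≤ span R (b '' T) := by
    rw [map_span, span_le]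
    rintro _ ⟨x, hx, rfl⟩
    exact b.mem_span_image.2 (Set.subset_biUnion_of_mem
      (u := fun x : N ↦ ((b.repr (x : M)).support : Set (Free.ChooseBasisIndex R M))) hx)
  have hN : N ≤ span R (b '' T) := by
    intro x hx
    obtain ⟨a, ha, hax⟩ := mem_torsionClosure.1 (htop.ge (mem_top (x := (⟨x, hx⟩ : N))))
    have := b.mem_span_image.1 (hsT (mem_map_of_mem hax))
    rw [map_smul, map_smul, Finsupp.support_smul_eq ha] at this
    exact b.mem_span_image.2 this
  have : Module.Finite R (span R (b '' T)) := .span_of_finite R (hT.image b)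
  exact .of_injective (inclusion hN) (inclusion_injective hN)

lemma exists_isCompl_of_projective_map {R M : Type*} [Ring R] [AddCommGroup M] [Module R M]
    {N P : Submodule R M} (hNP : N ≤ P) [Projective R (P.map N.mkQ)] :
    ∃ C : Submodule R M, Disjoint N C ∧ N ⊔ C = P := by
  obtain ⟨g, hg⟩ := projective_lifting_property (N.mkQ.submoduleMap P) .id
    (N.mkQ.submoduleMap_surjective P)
  have hg' (y) : N.mkQ (g y) = y := congr_arg Subtype.val (LinearMap.congr_fun hg y)
  refine ⟨LinearMap.range (P.subtype ∘ₗ g), ?_, le_antisymm (sup_le hNP ?_) fun x hx ↦ ?_⟩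
  · rw [disjoint_def]
    rintro _ hx ⟨y, rfl⟩
    have hy : y = 0 := Subtype.ext <| by
      rw [← hg' y]
      exact (Quotient.mk_eq_zero N).2 hx
    simp [hy]
  · rintro _ ⟨y, rfl⟩
    exact (g y).2
  · let y : P.map N.mkQ := ⟨N.mkQ x, mem_map_of_mem hx⟩
    rw [← sub_add_cancel x (g y : M)]
    refine add_mem_sup ?_ ⟨y, rfl⟩
    rw [← Quotient.mk_eq_zero, Quotient.mk_sub, sub_eq_zero]
    exact (hg' y).symm

end Submodule

/-- If each new term of a sequence is disjoint from a submodule containing the previous terms,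
then the sequence is independent. -/
lemma iSupIndep_of_disjoint_of_sup_eq {R M : Type*} [Ring R] [AddCommGroup M] [Module R M]
    {H C : ℕ → Submodule R M} (hdisj : ∀ n, Disjoint (H n) (C n))
    (hsup : ∀ n, H n ⊔ C n = H (n + 1)) : iSupIndep C := by
  have hmono : Monotone H := monotone_nat_of_le_succ fun n ↦ hsup n ▸ le_sup_left
  have hrange (n : ℕ) : (Finset.range n).SupIndep C := by
    induction n with
    | zero => simp
    | succ n ih =>
      rw [Finset.range_add_one]
      refine ih.insert ((hdisj n).symm.mono_right (Finset.sup_le fun i hi ↦ ?_))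
      exact (hsup i ▸ le_sup_right : C i ≤ H (i + 1)).trans (hmono (Finset.mem_range.1 hi))
  refine iSupIndep_iff_supIndep.2 fun s ↦ ?_
  obtain ⟨n, hn⟩ := s.exists_nat_subset_range
  exact (hrange n).subset hn

/-- A module is free if it is the union of a sequence of submodules starting at `⊥` in which each
term has a free complement in the next one. -/
lemma Module.Free.of_iSup_eq_top {R M : Type*} [Ring R] [AddCommGroup M] [Module R M]
    {H C : ℕ → Submodule R M} [∀ n, Module.Free R (C n)] (hbot : H 0 = ⊥) (htop : ⨆ n, H n = ⊤)
    (hdisj : ∀ n, Disjoint (H n) (C n)) (hsup : ∀ n, H n ⊔ C n = H (n + 1)) :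
    Module.Free R M := by
  have hle (n : ℕ) : H n ≤ ⨆ n, C n := by
    induction n with
    | zero => simp [hbot]
    | succ n ih => exact hsup n ▸ sup_le ih (le_iSup C n)
  have hC : DirectSum.IsInternal C :=
    DirectSum.isInternal_submodule_of_iSupIndep_of_iSup_eq_top
      (iSupIndep_of_disjoint_of_sup_eq hdisj hsup) (eq_top_iff.2 (htop ▸ iSup_le hle))
  exact .of_basis (hC.collectedBasis fun n ↦ Free.chooseBasis R (C n))

/-- A countable torsion-free module over a principal ideal domain is free if all its submodules of
finite rank are free. -/
lemma Module.Free.of_forall_rank_lt_aleph0 {R M : Type*} [CommRing R] [IsDomain R]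
    [IsPrincipalIdealRing R] [AddCommGroup M] [Module R M] [IsTorsionFree R M] [Countable M]
    (h : ∀ N : Submodule R M, Module.rank R N < ℵ₀ → Module.Free R N) : Module.Free R M := by
  obtain ⟨g, hg⟩ := exists_surjective_nat M
  let H (n : ℕ) : Submodule R M := (Submodule.span R (g '' Set.Iio n)).torsionClosure
  have hmono : Monotone H := fun m n hmn ↦ Submodule.torsionClosure_mono
    (Submodule.span_mono (Set.image_mono (Set.Iio_subset_Iio hmn)))
  have hfin (n : ℕ) : Module.Finite R (H n) := by
    have hrank : Module.rank R (H n) < ℵ₀ := by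
      rw [Submodule.rank_torsionClosure]
      exact (rank_span_le _).trans_lt (((Set.finite_Iio n).image g).lt_aleph0)
    have := h (H n) hrank
    exact rank_lt_aleph0_iff.1 hrank
  have hcompl (n : ℕ) : ∃ C, Disjoint (H n) C ∧ H n ⊔ C = H (n + 1) := by
    have : Module.Finite R ((H (n + 1)).map (H n).mkQ) := inferInstance
    have : IsTorsionFree R (M ⧸ H n) := Submodule.isTorsionFree_quotient_torsionClosure _
    exact Submodule.exists_isCompl_of_projective_map (hmono n.le_succ)
  choose C hdisj hsup using hcompl
  have hC (n : ℕ) : Module.Free R (C n) := by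
    have hle : C n ≤ H (n + 1) := hsup n ▸ le_sup_right
    have : Module.Finite R (C n) :=
      .of_injective (Submodule.inclusion hle) (Submodule.inclusion_injective hle)
    infer_instance
  refine .of_iSup_eq_top (H := H) ?_ (eq_top_iff.2 fun x _ ↦ ?_) hdisj hsup
  · simp [H, Submodule.torsionClosure_bot]
  · obtain ⟨n, rfl⟩ := hg x
    exact Submodule.mem_iSup_of_mem (n + 1) (Submodule.le_torsionClosure _
      (Submodule.subset_span ⟨n, n.lt_succ_self, rfl⟩))

/-- **Pontryagin's Criterion.** A countable torsion-free abelian group is free (as a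
`ℤ`-module) if and only if every subgroup of finite torsion-free rank is free. -/
theorem pontryagin_criterion {G : Type*} [AddCommGroup G] [Countable G]
    (hG : ∀ (g : G) (n : ℤ), n • g = 0 → g = 0 ∨ n = 0) :
    Module.Free ℤ G ↔
      ∀ H : AddSubgroup G, Module.rank ℤ ↥H < Cardinal.aleph0 → Module.Free ℤ ↥H := by
  have : IsTorsionFree ℤ G := .of_smul_eq_zero fun n g h ↦ (hG g n h).symm
  refine ⟨fun _ H hH ↦ ?_, fun h ↦ .of_forall_rank_lt_aleph0 fun N hN ↦ h N.toAddSubgroup hN⟩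
  have : Module.Finite ℤ H.toIntSubmodule := Submodule.finite_of_rank_lt_aleph0 _ hH
  exact inferInstanceAs (Module.Free ℤ H.toIntSubmodule)
end

section
/- An abelian group G is ℵ₁-free if and only if every subgroup of G of finite torsion-free rank is free. -/
/-- An abelian group is `ℵ₁`-free if every countable subgroup is free as a `ℤ`-module. -/
def Aleph1Free (G : Type*) [AddCommGroup G] : Prop :=
  ∀ H : AddSubgroup G, Countable H → Module.Free ℤ ↥H

open Module Submodule
open scoped nonZeroDivisors

section PontryaginCriterion

variable {R M : Type*} [CommRing R] [AddCommGroup M] [Module R M]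

/-- The saturation of a submodule `N` of `M`: the elements of `M` with a regular multiple
in `N`. -/
def Submodule.saturation (N : Submodule R M) : Submodule R M :=
  (torsion R (M ⧸ N)).comap N.mkQ

namespace Submodule

theorem mem_saturation {N : Submodule R M} {x : M} :
    x ∈ N.saturation ↔ ∃ a : R⁰, a • x ∈ N := by
  simp only [saturation, mem_comap, mem_torsion_iff, Submonoid.smul_def, mkQ_apply,
    ← Quotient.mk_smul, Quotient.mk_eq_zero]

theorem le_saturation (N : Submodule R M) : N ≤ N.saturation := fun x hx ↦
  mem_saturation.2 ⟨1, by simpa using hx⟩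

theorem saturation_mono : Monotone (saturation : Submodule R M → Submodule R M) :=
  fun N N' h x hx ↦ by
    obtain ⟨a, ha⟩ := mem_saturation.1 hx
    exact mem_saturation.2 ⟨a, h ha⟩

variable [IsDomain R]

theorem isTorsionFree_quotient_saturation (N : Submodule R M) :
    IsTorsionFree R (M ⧸ N.saturation) := by
  refine isTorsionFree_iff_smul_eq_zero.2 fun r m h ↦ or_iff_not_imp_left.2 fun hr ↦ ?_
  obtain ⟨x, rfl⟩ := N.saturation.mkQ_surjective m
  rw [← map_smul, mkQ_apply, Quotient.mk_eq_zero, mem_saturation] at h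
  obtain ⟨a, ha⟩ := h
  rw [mkQ_apply, Quotient.mk_eq_zero, mem_saturation]
  refine ⟨a * ⟨r, mem_nonZeroDivisors_of_ne_zero hr⟩, ?_⟩
  rwa [mul_smul]

theorem rank_saturation (N : Submodule R M) :
    Module.rank R N.saturation = Module.rank R N := by
  have htors : IsTorsion R (N.saturation ⧸ N.submoduleOf N.saturation) := fun {y} ↦ by
    obtain ⟨x, rfl⟩ := mkQ_surjective _ y
    obtain ⟨a, ha⟩ := mem_saturation.1 x.2
    refine ⟨a, ?_⟩
    rw [Submonoid.smul_def, ← map_smul, mkQ_apply, Quotient.mk_eq_zero]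
    exact ha
  rw [← rank_quotient_add_rank_of_isDomain (N.submoduleOf N.saturation), htors.rank_eq_zero,
    zero_add, (submoduleOfEquivOfLe N.le_saturation).rank_eq]

end Submodule

/-- If `N ≤ P` with `P` finitely generated and `M ⧸ N` torsion-free, then every basis of `N`
extends to a basis of `P`. -/
theorem LinearIndepOn.exists_superset_span_eq [IsDomain R] [IsPrincipalIdealRing R]
    {N P : Submodule R M} (hNP : N ≤ P) [Module.Finite R P] [IsTorsionFree R (M ⧸ N)]
    {s : Set M} (hs : LinearIndepOn R id s) (hsN : span R s = N) :
    ∃ t, s ⊆ t ∧ LinearIndepOn R id t ∧ span R t = P := by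
  have : Module.Finite R (P.map N.mkQ) := Module.Finite.map P N.mkQ
  let b := Free.chooseBasis R (P.map N.mkQ)
  choose v _ hv using fun i ↦ (b i).2
  have hvb : N.mkQ ∘ v = (P.map N.mkQ).subtype ∘ b := funext hv
  have hli : LinearIndependent R (N.mkQ ∘ v) := by
    rw [hvb]
    exact b.linearIndependent.map' _ (ker_subtype _)
  refine ⟨s ∪ Set.range v, Set.subset_union_left,
    hs.union_id_of_quotient (hsN ▸ subset_span)
    ((linearIndepOn_range_iff hli.injective.of_comp N.mkQ).2 hli), ?_⟩
  have hmap : (span R (Set.range v)).map N.mkQ = P.map N.mkQ := by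
    rw [map_span, ← Set.range_comp, hvb, Set.range_comp, ← map_span, b.span_eq, map_subtype_top]
  rw [span_union, hsN]
  have h := congrArg (comap N.mkQ) hmap
  rwa [comap_map_mkQ, comap_map_mkQ, sup_eq_right.2 hNP] at h

/-- **Pontryagin's criterion**: a countable module over a principal ideal domain is free if all
its submodules of finite rank are free. -/
theorem Module.Free.of_countable_of_finite_rank [IsDomain R] [IsPrincipalIdealRing R]
    [Countable M] (h : ∀ N : Submodule R M, Module.rank R N < Cardinal.aleph0 → Module.Free R N) :
    Module.Free R M := by
  obtain ⟨e, he⟩ := exists_surjective_nat M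
  let N (n : ℕ) : Submodule R M := (span R (e '' Set.Iio n)).saturation
  have hrank (n : ℕ) : Module.rank R (N n) < Cardinal.aleph0 := by
    rw [rank_saturation]
    exact (rank_span_le _).trans_lt ((Set.finite_Iio n).image e).lt_aleph0
  have hfree (n : ℕ) : Module.Free R (N n) := h _ (hrank n)
  have hfin (n : ℕ) : Module.Finite R (N n) := rank_lt_aleph0_iff.1 (hrank n)
  have htf (n : ℕ) : IsTorsionFree R (M ⧸ N n) := isTorsionFree_quotient_saturation _
  have hmono (n : ℕ) : N n ≤ N (n + 1) :=
    saturation_mono (span_mono (Set.image_mono (Set.Iio_subset_Iio n.le_succ)))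
  let B (n : ℕ) := {s : Set M // LinearIndepOn R id s ∧ span R s = N n}
  have hstep (n : ℕ) (s : B n) : ∃ t : B (n + 1), s.1 ⊆ t.1 := by
    obtain ⟨t, hst, ht, htN⟩ := s.2.1.exists_superset_span_eq (hmono n) s.2.2
    exact ⟨⟨t, ht, htN⟩, hst⟩
  choose next hnext using hstep
  let b := Free.chooseBasis R (N 0)
  let s₀ : B 0 := ⟨Set.range ((N 0).subtype ∘ b),
    (b.linearIndependent.map' _ (ker_subtype _)).linearIndepOn_id, by
      rw [Set.range_comp, ← map_span, b.span_eq, map_subtype_top]⟩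
  let S (n : ℕ) : B n := Nat.rec s₀ next n
  have hS : Monotone fun n ↦ (S n).1 := monotone_nat_of_le_succ fun n ↦ hnext n (S n)
  have hli : LinearIndepOn R id (⋃ n, (S n).1) :=
    linearIndepOn_iUnion_of_directed hS.directed_le fun n ↦ (S n).2.1
  refine Module.Free.of_basis (Basis.mk hli fun x _ ↦ ?_)
  obtain ⟨n, rfl⟩ := he x
  have hx : e n ∈ span R (S (n + 1)).1 := by
    rw [(S (n + 1)).2.2]
    exact le_saturation _ (subset_span ⟨n, n.lt_succ_self, rfl⟩)
  change e n ∈ span R (Set.range Subtype.val)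
  rw [Subtype.range_val]
  exact span_mono (Set.subset_iUnion (fun n ↦ (S n).1) (n + 1)) hx

/-- A torsion-free module of finite rank over a countable domain is countable. -/
theorem Countable.of_isTorsionFree_of_rank_lt_aleph0 [IsDomain R] [Countable R]
    [IsTorsionFree R M] (h : Module.rank R M < Cardinal.aleph0) : Countable M := by
  obtain ⟨s, hs, hli⟩ := exists_set_linearIndependent_of_isDomain R M
  have : Finite s := Cardinal.lt_aleph0_iff_finite.1 (hs ▸ h)
  have : Countable (span R s) := by
    simpa using (inferInstance : Countable (span R (Set.range ((↑) : s → M))))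
  have hrank := rank_quotient_add_rank_of_isDomain (span R s)
  rw [rank_span_set hli, hs] at hrank
  have htors : IsTorsion R (M ⧸ span R s) := Module.rank_eq_zero_iff_isTorsion.1
    (Cardinal.eq_of_add_eq_add_right (hrank.trans (zero_add _).symm) h)
  have hmul (x : M) : ∃ a : R⁰, a • x ∈ span R s :=
    mem_saturation.1 ((mem_torsion_iff _).2 (@htors ((span R s).mkQ x)))
  choose a ha using hmul
  refine Function.Injective.countable (f := fun x ↦ (a x, (⟨a x • x, ha x⟩ : span R s))) ?_
  intro x y hxy
  simp only [Prod.mk.injEq, Subtype.mk.injEq] at hxy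
  obtain ⟨h1, h2⟩ := hxy
  rw [h1] at h2
  exact smul_right_injective M (nonZeroDivisors.coe_ne_zero (a y)) h2

end PontryaginCriterion

theorem Aleph1Free.isTorsionFree {G : Type*} [AddCommGroup G] (hG : Aleph1Free G) :
    IsTorsionFree ℤ G := by
  refine isTorsionFree_iff_smul_eq_zero.2 fun r x h ↦ ?_
  have := hG (AddSubgroup.zmultiples x) inferInstance
  have hx : r • (⟨x, AddSubgroup.mem_zmultiples x⟩ : AddSubgroup.zmultiples x) = 0 :=
    Subtype.ext h
  simpa using hx

/-- An abelian group `G` is `ℵ₁`-free if and only if every subgroup of `G` of finite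
torsion-free rank is free. -/
theorem aleph1Free_iff_finiteRank_free {G : Type*} [AddCommGroup G] :
    Aleph1Free G ↔
      ∀ H : AddSubgroup G, Module.rank ℤ ↥H < Cardinal.aleph0 → Module.Free ℤ ↥H := by
  refine ⟨fun hG H hH ↦ ?_, fun hG H _ ↦ ?_⟩
  · have := hG.isTorsionFree
    have : IsTorsionFree ℤ H :=
      H.subtype_injective.moduleIsTorsionFree _ fun _ _ ↦ rfl
    exact hG H (Countable.of_isTorsionFree_of_rank_lt_aleph0 hH)
  · refine Module.Free.of_countable_of_finite_rank (R := ℤ) fun N hN ↦ ?_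
    let e : N ≃ₗ[ℤ] N.toAddSubgroup.map H.subtype :=
      (N.toAddSubgroup.equivMapOfInjective H.subtype H.subtype_injective).toIntLinearEquiv
    have := hG (N.toAddSubgroup.map H.subtype) (e.rank_eq ▸ hN)
    exact Module.Free.of_equiv e.symm
end

section
/- An abelian group G is ℵ₁-free if and only if G is torsion-free and for every finite subset S of G, the minimal pure subgroup ⟨S⟩* is free. -/
/-- The minimal pure subgroup `⟨S⟩*` of an abelian group `G` generated by a subset `S`. -/
def purify {G : Type*} [AddCommGroup G] (S : Set G) : AddSubgroup G where
  carrier := {y : G | ∃ n : ℤ, n ≠ 0 ∧ n • y ∈ AddSubgroup.closure S}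
  zero_mem' := ⟨1, one_ne_zero, by simpa using (AddSubgroup.closure S).zero_mem⟩
  add_mem' := by
    rintro a b ⟨n, hn, ha⟩ ⟨m, hm, hb⟩
    refine ⟨n * m, mul_ne_zero hn hm, ?_⟩
    rw [smul_add]
    refine add_mem ?_ ?_
    · rw [mul_comm, mul_smul]
      exact AddSubgroup.zsmul_mem _ ha m
    · rw [mul_smul]
      exact AddSubgroup.zsmul_mem _ hb n
  neg_mem' := by
    rintro a ⟨n, hn, ha⟩
    exact ⟨n, hn, by rw [smul_neg]; exact neg_mem ha⟩

open Module

/-- A module with a countable exhaustive filtration starting at `⊥`, each step of which splits off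
a free complement, is free. -/
theorem Module.Free.of_nat_filtration {R M : Type*} [Ring R] [AddCommGroup M] [Module R M]
    (P C : ℕ → Submodule R M) (hzero : P 0 = ⊥) (htop : ⨆ n, P n = ⊤)
    (hdisj : ∀ n, Disjoint (P n) (C n)) (hsup : ∀ n, P n ⊔ C n = P (n + 1))
    (hfree : ∀ n, Module.Free R (C n)) : Module.Free R M := by
  have hmono : Monotone P := monotone_nat_of_le_succ fun n ↦ hsup n ▸ le_sup_left
  have hindep : iSupIndep C := by
    rw [iSupIndep_iff_finsetSum_eq_zero_imp_eq_zero]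
    intro s
    induction s using Finset.induction_on_max with
    | empty => simp
    | insert m t hlt ih =>
      intro v hv hsum
      rw [Finset.sum_insert fun hm ↦ (hlt m hm).false] at hsum
      have hmem : ∑ i ∈ t, v i ∈ P m := Submodule.sum_mem _ fun i hi ↦
        hmono (hlt i hi) (hsup i ▸ Submodule.mem_sup_right (hv i (Finset.mem_insert_of_mem hi)))
      have hvm : v m = 0 := Submodule.disjoint_def.1 (hdisj m) _
        (eq_neg_of_add_eq_zero_left hsum ▸ neg_mem hmem) (hv m (Finset.mem_insert_self m t))
      rw [hvm, zero_add] at hsum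
      intro i hi
      rcases Finset.mem_insert.1 hi with rfl | hi
      · exact hvm
      · exact ih v (fun j hj ↦ hv j (Finset.mem_insert_of_mem hj)) hsum i hi
  have hspan : ⨆ n, C n = ⊤ := by
    refine top_le_iff.1 (htop ▸ iSup_le fun n ↦ ?_)
    induction n with
    | zero => simp [hzero]
    | succ n ih => exact hsup n ▸ sup_le ih (le_iSup C n)
  exact Module.Free.of_equiv (LinearEquiv.ofBijective (DirectSum.coeLinearMap C)
    (DirectSum.isInternal_submodule_of_iSupIndep_of_iSup_eq_top hindep hspan))

/-- A pure submodule of a finitely generated submodule over a PID has a free complement in it. -/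
theorem Submodule.exists_free_complement_of_pure {R M : Type*} [CommRing R] [IsDomain R]
    [IsPrincipalIdealRing R] [AddCommGroup M] [Module R M] {P Q : Submodule R M} (hPQ : P ≤ Q)
    [Module.Finite R Q] (hpure : ∀ (r : R) (x : M), r ≠ 0 → r • x ∈ P → x ∈ P) :
    ∃ C : Submodule R M, Disjoint P C ∧ P ⊔ C = Q ∧ Module.Free R C := by
  let K : Submodule R Q := P.submoduleOf Q
  have htf : IsTorsionFree R (Q ⧸ K) := by
    refine .of_smul_eq_zero fun r y hy ↦ ?_
    obtain ⟨x, rfl⟩ := K.mkQ_surjective y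
    refine or_iff_not_imp_left.2 fun hr ↦ ?_
    rw [← map_smul, mkQ_apply, Quotient.mk_eq_zero] at hy
    exact (Quotient.mk_eq_zero K).2 (hpure r x hr hy)
  obtain ⟨s, hs⟩ := Module.projective_lifting_property K.mkQ LinearMap.id K.mkQ_surjective
  have hs' (y : Q ⧸ K) : K.mkQ (s y) = y := LinearMap.congr_fun hs y
  have hinj : Function.Injective (Q.subtype ∘ₗ s) :=
    Q.subtype_injective.comp (Function.LeftInverse.injective hs')
  refine ⟨LinearMap.range (Q.subtype ∘ₗ s), ?_, le_antisymm (sup_le hPQ ?_) fun x hx ↦ ?_,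
    Module.Free.of_equiv (LinearEquiv.ofInjective _ hinj)⟩
  · rw [Submodule.disjoint_def]
    rintro _ hx ⟨y, rfl⟩
    have hy : y = 0 := by
      rw [← hs' y, mkQ_apply, Quotient.mk_eq_zero]
      exact hx
    rw [hy, map_zero]
  · rintro _ ⟨y, rfl⟩
    exact (s y).2
  · refine Submodule.mem_sup.2 ⟨x - s (K.mkQ ⟨x, hx⟩), ?_, _, ⟨K.mkQ ⟨x, hx⟩, rfl⟩, by simp⟩
    have : K.mkQ (⟨x, hx⟩ - s (K.mkQ ⟨x, hx⟩)) = 0 := by rw [map_sub, hs', sub_self]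
    exact (Quotient.mk_eq_zero K).1 this

section Purify

variable {G : Type*} [AddCommGroup G]

theorem subset_purify (S : Set G) : S ⊆ purify S := fun x hx ↦
  ⟨1, one_ne_zero, by simpa using AddSubgroup.subset_closure hx⟩

theorem purify_mono {S T : Set G} (h : S ⊆ T) : purify S ≤ purify T := fun _ ⟨n, hn, hx⟩ ↦
  ⟨n, hn, AddSubgroup.closure_mono h hx⟩

theorem mem_purify_of_zsmul_mem {S : Set G} {n : ℤ} {x : G} (hn : n ≠ 0)
    (hx : n • x ∈ purify S) : x ∈ purify S := by
  obtain ⟨m, hm, hmx⟩ := hx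
  exact ⟨m * n, mul_ne_zero hm hn, by rwa [mul_smul]⟩

theorem purify_empty [IsTorsionFree ℤ G] : purify (∅ : Set G) = ⊥ := by
  refine (AddSubgroup.eq_bot_iff_forall _).2 ?_
  rintro x ⟨n, hn, hx⟩
  rw [AddSubgroup.closure_empty, AddSubgroup.mem_bot] at hx
  exact (smul_eq_zero.1 hx).resolve_left hn

theorem countable_purify [IsTorsionFree ℤ G] {S : Set G} (hS : S.Countable) :
    Countable (purify S) := by
  have : Countable S := hS
  have : Countable (AddSubgroup.closure S) := by
    have : Countable (Submodule.span ℤ (Set.range ((↑) : S → G))) := inferInstance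
    rw [Subtype.range_coe, ← AddSubgroup.toIntSubmodule_closure] at this
    exact this
  choose n hn hmem using fun x : purify S ↦ x.2
  refine Function.Injective.countable
    (f := fun x ↦ (n x, (⟨n x • (x : G), hmem x⟩ : AddSubgroup.closure S))) fun x y hxy ↦ ?_
  simp only [Prod.mk.injEq, Subtype.mk.injEq] at hxy
  obtain ⟨h, h'⟩ := hxy
  rw [← h] at h'
  exact Subtype.ext (smul_right_injective G (hn x) h')

/-- If the pure subgroup generated by a finite set is free, then it is finitely generated. -/
theorem finite_purify_of_free (S : Finset G) [Module.Free ℤ (purify (S : Set G))] :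
    Module.Finite ℤ (purify (S : Set G)) := by
  classical
  let b := Module.Free.chooseBasis ℤ (purify (S : Set G))
  let T := S.attach.biUnion fun x ↦ (b.repr ⟨x, subset_purify _ x.2⟩).support
  have hsupp (y : purify (S : Set G)) (hy : (y : G) ∈ AddSubgroup.closure (S : Set G)) :
      (b.repr y).support ⊆ T := by
    have hle : AddSubgroup.closure (S : Set G) ≤
        ((Finsupp.supported ℤ ℤ (T : Set _)).comap b.repr.toLinearMap).toAddSubgroup.map
          (purify (S : Set G)).subtype := by
      rw [AddSubgroup.closure_le]
      intro x hx
      refine ⟨⟨x, subset_purify _ hx⟩, ?_, rfl⟩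
      exact (Finsupp.mem_supported ℤ _).2 (Finset.coe_subset.2
        (Finset.subset_biUnion_of_mem (fun x : S ↦ (b.repr ⟨x, subset_purify _ x.2⟩).support)
          (Finset.mem_attach S ⟨x, hx⟩)))
    obtain ⟨z, hz, hzy⟩ := hle hy
    obtain rfl : z = y := Subtype.ext hzy
    exact Finset.coe_subset.1 ((Finsupp.mem_supported ℤ _).1 hz)
  have hT (i) : i ∈ T := by
    obtain ⟨n, hn, hmem⟩ := (b i).2
    refine hsupp (n • b i) hmem ?_
    simpa using hn
  have : Finite (Module.Free.ChooseBasisIndex ℤ (purify (S : Set G))) :=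
    Finite.of_injective (fun i ↦ (⟨i, hT i⟩ : T)) fun i j h ↦ congrArg Subtype.val h
  exact Module.Finite.of_basis b

theorem isTorsionFree_of_aleph1Free (hG : Aleph1Free G) : IsTorsionFree ℤ G := by
  refine .of_smul_eq_zero fun n g h ↦ ?_
  have := hG (AddSubgroup.zmultiples g) inferInstance
  have h' : n • (⟨g, AddSubgroup.mem_zmultiples g⟩ : AddSubgroup.zmultiples g) = 0 := Subtype.ext h
  exact (smul_eq_zero.1 h').imp_right fun h ↦ congrArg Subtype.val h

/-- **Pontryagin's criterion**: a torsion-free group is `ℵ₁`-free as soon as the pure subgroups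
generated by its finite subsets are free. -/
theorem aleph1Free_of_free_purify [IsTorsionFree ℤ G]
    (hfree : ∀ S : Finset G, Module.Free ℤ (purify (S : Set G))) : Aleph1Free G := by
  classical
  intro H hH
  obtain ⟨e, he⟩ := exists_surjective_nat H
  let S (n : ℕ) : Finset G := (Finset.range n).image fun i ↦ (e i : G)
  let P (n : ℕ) : Submodule ℤ H :=
    AddSubgroup.toIntSubmodule ((purify (S n : Set G)).addSubgroupOf H)
  have hmem (n : ℕ) (x : H) : x ∈ P n ↔ (x : G) ∈ purify (S n : Set G) := Iff.rfl
  have hmono (n : ℕ) : P n ≤ P (n + 1) := fun x hx ↦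
    purify_mono (Finset.coe_subset.2 (Finset.image_subset_image
      (Finset.range_subset_range.2 n.le_succ))) hx
  have hfin (n : ℕ) : Module.Finite ℤ (P n) := by
    have := hfree (S n)
    have := finite_purify_of_free (S n)
    let f : P n →+ purify (S n : Set G) :=
      { toFun := fun x ↦ ⟨x, x.2⟩, map_zero' := rfl, map_add' := fun _ _ ↦ rfl }
    exact Module.Finite.of_injective f.toIntLinearMap fun x y hxy ↦
      Subtype.ext (Subtype.ext (congrArg (fun z : purify (S n : Set G) ↦ (z : G)) hxy))
  choose C hdisj hsup hC using fun n ↦ Submodule.exists_free_complement_of_pure (hmono n)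
    fun r x hr hx ↦ (hmem n x).2 (mem_purify_of_zsmul_mem hr hx)
  refine Module.Free.of_nat_filtration P C ?_ ?_ hdisj hsup hC
  · refine (Submodule.eq_bot_iff _).2 fun x hx ↦ ?_
    rw [hmem] at hx
    simpa [S, purify_empty] using hx
  · refine top_le_iff.1 fun x _ ↦ ?_
    obtain ⟨n, rfl⟩ := he x
    refine Submodule.mem_iSup_of_mem (n + 1) (subset_purify _ ?_)
    exact Finset.mem_coe.2 (Finset.mem_image_of_mem _ (Finset.self_mem_range_succ n))

end Purify

/-- An abelian group `G` is `ℵ₁`-free if and only if `G` is torsion-free and for every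
finite subset `S` of `G` the minimal pure subgroup `⟨S⟩*` is free. -/
theorem aleph1Free_iff_purify_free {G : Type*} [AddCommGroup G] :
    Aleph1Free G ↔
      ((∀ (g : G) (n : ℤ), n • g = 0 → g = 0 ∨ n = 0) ∧
        ∀ S : Finset G, Module.Free ℤ ↥(purify (S : Set G))) := by
  constructor
  · intro hG
    have := isTorsionFree_of_aleph1Free hG
    exact ⟨fun g n h ↦ (smul_eq_zero.1 h).symm,
      fun S ↦ hG _ (countable_purify S.countable_toSet)⟩
  · rintro ⟨htf, hfree⟩
    have : IsTorsionFree ℤ G := .of_smul_eq_zero fun n g h ↦ (htf g n h).symm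
    exact aleph1Free_of_free_purify hfree
end

section
/- Let G be an abelian group and H a subgroup of G. If H is ℵ₁-free and the quotient group G/H is ℵ₁-free, then G is ℵ₁-free. -/
/-- An extension of a free module by a free module is free. -/
theorem Module.Free.of_surjective_of_ker {R M N : Type*} [Ring R] [AddCommGroup M] [AddCommGroup N]
    [Module R M] [Module R N] (f : M →ₗ[R] N) (hf : Function.Surjective f)
    [Module.Free R (LinearMap.ker f)] [Module.Free R N] : Module.Free R M := by
  obtain ⟨g, hg⟩ := f.exists_rightInverse_of_surjective (LinearMap.range_eq_top.2 hf)
  exact Module.Free.of_equiv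
    ((LinearMap.exact_subtype_ker_map f).splitSurjectiveEquiv
      (LinearMap.ker f).injective_subtype ⟨g, hg⟩).1.symm

/-- If `H` is a subgroup of an abelian group `G` such that both `H` and `G/H` are
`ℵ₁`-free, then `G` is `ℵ₁`-free. -/
theorem aleph1Free_of_aleph1Free_of_quotient {G : Type*} [AddCommGroup G]
    (H : AddSubgroup G) (hH : Aleph1Free ↥H) (hQ : Aleph1Free (G ⧸ H)) :
    Aleph1Free G := by
  intro K hK
  let f : K →+ G ⧸ H := (QuotientAddGroup.mk' H).comp K.subtype
  have hmem (x : K) : x ∈ LinearMap.ker f.rangeRestrict.toIntLinearMap ↔ (x : G) ∈ H := by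
    rw [LinearMap.mem_ker, ← QuotientAddGroup.eq_zero_iff (N := H), ← Subtype.coe_inj]
    rfl
  have : Module.Free ℤ f.range := hQ f.range f.rangeRestrict_surjective.countable
  have hinj : Function.Injective
      (fun x : K.addSubgroupOf H => (⟨(x : H), x.2⟩ : K)) := fun x y h =>
    Subtype.ext (Subtype.ext (congrArg (fun z : K => (z : G)) h))
  have : Module.Free ℤ (K.addSubgroupOf H) := hH _ hinj.countable
  let e : K.addSubgroupOf H ≃+ LinearMap.ker f.rangeRestrict.toIntLinearMap :=
    { toFun x := ⟨⟨(x : H), x.2⟩, (hmem _).2 (x : H).2⟩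
      invFun x := ⟨⟨(x : K), (hmem _).1 x.2⟩, (x : K).2⟩
      left_inv _ := rfl
      right_inv _ := rfl
      map_add' _ _ := rfl }
  have : Module.Free ℤ (LinearMap.ker f.rangeRestrict.toIntLinearMap) :=
    Module.Free.of_equiv e.toIntLinearEquiv
  exact Module.Free.of_surjective_of_ker f.rangeRestrict.toIntLinearMap
    f.rangeRestrict_surjective
end

section
/- Let G be a free abelian group and H a finitely generated pure subgroup of G. Then H is a direct summand of G and the quotient group G/H is free. -/
/-- A subgroup `H` of an abelian group `G` is pure if whenever `x ∈ H` is divisible by a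
nonzero integer `n` in `G`, it is divisible by `n` in `H`. -/
def IsPureSubgroup {G : Type*} [AddCommGroup G] (H : AddSubgroup G) : Prop :=
  ∀ x ∈ H, ∀ n : ℤ, n ≠ 0 → (∃ y : G, x = n • y) → ∃ h ∈ H, x = n • h

open Submodule in
/-- A finitely generated submodule of a free module is contained in a finitely generated free
submodule that admits a free complement. -/
theorem Submodule.FG.exists_le_isCompl_free {R M : Type*} [CommRing R] [AddCommGroup M]
    [Module R M] [Module.Free R M] {N : Submodule R M} (hN : N.FG) :
    ∃ F C : Submodule R M, N ≤ F ∧ IsCompl F C ∧ F.FG ∧ Module.Free R C := by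
  classical
  obtain ⟨t, rfl⟩ := hN
  let b := Module.Free.chooseBasis R M
  let s : Finset (Module.Free.ChooseBasisIndex R M) := t.biUnion fun x ↦ (b.repr x).support
  refine ⟨span R (b '' s), span R (b '' (s : Set _)ᶜ), span_le.2 fun x hx ↦ ?_,
    b.linearIndependent.isCompl_span_image b.span_eq isCompl_compl,
    fg_span (s.finite_toSet.image b), ?_⟩
  · refine span_mono (Set.image_mono ?_) (b.mem_span_repr_support x)
    exact_mod_cast Finset.subset_biUnion_of_mem (fun x ↦ (b.repr x).support) hx
  · rw [Set.image_eq_range]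
    exact .of_basis (Module.Basis.span
      (b.linearIndependent.comp Subtype.val Subtype.val_injective))

/-- A torsion-free quotient of a free module over a principal ideal domain by a finitely generated
submodule is free. -/
theorem Module.Free.quotient_of_fg {R M : Type*} [CommRing R] [IsDomain R]
    [IsPrincipalIdealRing R] [AddCommGroup M] [Module R M] [Module.Free R M]
    {N : Submodule R M} (hN : N.FG) [Module.IsTorsionFree R (M ⧸ N)] :
    Module.Free R (M ⧸ N) := by
  obtain ⟨F, C, hNF, hFC, hF, hC⟩ := hN.exists_le_isCompl_free
  have : Module.Finite R F := .of_fg hF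
  let i : (F ⧸ N.submoduleOf F) →ₗ[R] M ⧸ N := (N.submoduleOf F).mapQ N F.subtype le_rfl
  have hi : Function.Injective i := by
    rw [← LinearMap.ker_eq_bot]
    exact Submodule.ker_liftQ_eq_bot _ _ _ (by rw [LinearMap.ker_comp, Submodule.ker_mkQ]; rfl)
  have : Module.IsTorsionFree R (F ⧸ N.submoduleOf F) :=
    hi.moduleIsTorsionFree _ fun r x ↦ map_smul i r x
  let e := Submodule.prodEquivOfIsCompl F C hFC
  let π : M →ₗ[R] (F ⧸ N.submoduleOf F) × C :=
    ((N.submoduleOf F).mkQ.prodMap LinearMap.id) ∘ₗ e.symm.toLinearMap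
  have hπ : Function.Surjective π :=
    ((Submodule.mkQ_surjective _).prodMap Function.surjective_id).comp e.symm.surjective
  have hker : LinearMap.ker π = N := by
    ext x
    obtain ⟨⟨f, c⟩, rfl⟩ := e.surjective x
    have he : e (f, c) = f + c := Submodule.coe_prodEquivOfIsCompl' _ _ _ _
    have hmem : π (e (f, c)) = 0 ↔ (f : M) ∈ N ∧ c = 0 := by
      have hf : f ∈ N.submoduleOf F ↔ (f : M) ∈ N := Iff.rfl
      simp [π, hf]
    rw [LinearMap.mem_ker, hmem]
    constructor
    · rintro ⟨hf, rfl⟩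
      simpa [he] using hf
    · intro h
      have hc : c = 0 := by
        refine Subtype.ext (Submodule.disjoint_def.1 hFC.disjoint c ?_ c.2)
        have := F.sub_mem (hNF h) f.2
        rwa [he, add_sub_cancel_left] at this
      subst hc
      exact ⟨by simpa [he] using h, rfl⟩
  exact .of_equiv ((Submodule.quotEquivOfEq _ _ hker.symm).trans
    (π.quotKerEquivOfSurjective hπ)).symm

/-- A submodule with projective quotient has a complement. -/
theorem Submodule.exists_isCompl_of_projective_quotient {R M : Type*} [Ring R] [AddCommGroup M]
    [Module R M] (N : Submodule R M) [Module.Projective R (M ⧸ N)] :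
    ∃ K : Submodule R M, IsCompl N K := by
  obtain ⟨g, hg⟩ := Module.projective_lifting_property N.mkQ .id N.mkQ_surjective
  have hg' (y : M ⧸ N) : N.mkQ (g y) = y := LinearMap.congr_fun hg y
  refine ⟨LinearMap.range g, Submodule.disjoint_def.2 ?_, codisjoint_iff.2 (eq_top_iff.2 ?_)⟩
  · rintro _ hx ⟨y, rfl⟩
    have hy : y = 0 := by rw [← hg' y, ← LinearMap.mem_ker, N.ker_mkQ]; exact hx
    rw [hy, map_zero]
  · intro x _
    refine Submodule.mem_sup.2 ⟨x - g (N.mkQ x), ?_, _, ⟨N.mkQ x, rfl⟩, sub_add_cancel _ _⟩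
    refine (Submodule.Quotient.mk_eq_zero N).1 ?_
    rw [← N.mkQ_apply, map_sub, hg', sub_self]

/-- The quotient of a torsion-free abelian group by a pure subgroup is torsion-free. -/
theorem IsPureSubgroup.isTorsionFree_quotient {G : Type*} [AddCommGroup G]
    [Module.IsTorsionFree ℤ G] {H : AddSubgroup G} (hH : IsPureSubgroup H) :
    Module.IsTorsionFree ℤ (G ⧸ AddSubgroup.toIntSubmodule H) := by
  refine Module.isTorsionFree_iff_smul_eq_zero.2 fun n x hx ↦ ?_
  obtain ⟨g, rfl⟩ := Submodule.mkQ_surjective _ x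
  refine or_iff_not_imp_left.2 fun hn ↦ ?_
  rw [← map_smul, ← LinearMap.mem_ker, Submodule.ker_mkQ] at hx
  obtain ⟨h, hh, hgh⟩ := hH (n • g) hx n hn ⟨g, rfl⟩
  rw [← LinearMap.mem_ker, Submodule.ker_mkQ, smul_right_injective G hn hgh]
  exact hh

/-- If `G` is a free abelian group and `H` is a finitely generated pure subgroup of `G`,
then `H` is a direct summand of `G` and `G/H` is free. -/
theorem pure_fg_subgroup_isDirectSummand {G : Type*} [AddCommGroup G]
    [Module.Free ℤ G] (H : AddSubgroup G) (hfg : H.FG) (hpure : IsPureSubgroup H) :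
    (∃ K : AddSubgroup G, H ⊓ K = ⊥ ∧ H ⊔ K = ⊤) ∧ Module.Free ℤ (G ⧸ H) := by
  have := hpure.isTorsionFree_quotient
  have hfree : Module.Free ℤ (G ⧸ AddSubgroup.toIntSubmodule H) :=
    .quotient_of_fg ((Submodule.fg_iff_addSubgroup_fg _).2 hfg)
  refine ⟨?_, hfree⟩
  obtain ⟨K, hK⟩ := (AddSubgroup.toIntSubmodule H).exists_isCompl_of_projective_quotient
  have hHK := (AddSubgroup.toIntSubmodule (M := G)).symm.isCompl hK
  exact ⟨K.toAddSubgroup, hHK.inf_eq_bot, hHK.sup_eq_top⟩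
end
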